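/- arXiv:2211.12478 — 5 statements merged into one kernel-verified Lean document; each statement's English description precedes it below -/
import Mathlib

section
/- (Recursive feasibility.) Let Θ_{t+1} ⊆ Θ_t ⊆ Θ_0 ⊆ ℝ^p and suppose the terminal conditions hold: 𝒳_T ⊆ 𝒳, K𝒳_T ⊕ 𝒮 ⊆ 𝒰, and A_K(θ)𝒳 ⊕ B(θ)𝒮 ⊕ F𝒲 ⊆ 𝒳_T for all θ ∈ Θ_0. Suppose the tube 𝒳_{0|t}, …, 𝒳_{N|t} ⊆ ℝ^{n_x} and inputs v_{0|t}, …, v_{N−1|t} ∈ ℝ^{n_u} satisfy, for all θ ∈ Θ_t and k ∈ {0,…,N−1}: 𝒳_{k|t} ⊆ 𝒳, K𝒳_{k|t} ⊕ {v_{k|t}} ⊆ 𝒰, A_K(θ)𝒳_{k|t} ⊕ {B(θ)v_{k|t}} ⊕ F𝒲 ⊆ 𝒳_{k+1|t}, together with x_t ∈ 𝒳_{0|t} and 𝒳_{N|t} ⊆ 𝒳_T. Let x_{t+1} = A_K(θ*) x_t + B(θ*) v_{0|t} + F w_t with θ* ∈ Θ_{t+1} (hence θ* ∈ Θ_t) and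 w_t ∈ 𝒲, and let s ∈ 𝒮. Then the shifted tube (𝒳_{1|t}, …, 𝒳_{N|t}, 𝒳_T) together with the shifted inputs (v_{1|t}, …, v_{N−1|t}, s) satisfies the same constraints at time t+1 with parameter set Θ_{t+1}: each tube set is contained in 𝒳, each input constraint K𝒳 ⊕ {v} ⊆ 𝒰 holds, the recurrence inclusions hold for all θ ∈ Θ_{t+1}, x_{t+1} lies in the first tube set 𝒳_{1|t}, and the last tube set 𝒳_T is contained in 𝒳_T. -/
open Matrix Finset Pointwise

/-- Recursive feasibility: if the tube and inputs are feasible at time `t` with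
parameter set `Θt`, then the shifted tube `(𝒳_{1|t},…,𝒳_{N|t},𝒳_T)` with shifted
inputs `(v_{1|t},…,v_{N-1|t}, s)` is feasible at time `t+1` with the (smaller)
parameter set `Θt1`. -/
theorem recursive_feasibility
    {nx nu nw p N : ℕ} (hN : 1 ≤ N)
    (A0 : Matrix (Fin nx) (Fin nx) ℝ) (B0 : Matrix (Fin nx) (Fin nu) ℝ)
    (Ai : Fin p → Matrix (Fin nx) (Fin nx) ℝ) (Bi : Fin p → Matrix (Fin nx) (Fin nu) ℝ)
    (A : (Fin p → ℝ) → Matrix (Fin nx) (Fin nx) ℝ)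
    (hA : ∀ θ, A θ = A0 + ∑ i, θ i • Ai i)
    (B : (Fin p → ℝ) → Matrix (Fin nx) (Fin nu) ℝ)
    (hB : ∀ θ, B θ = B0 + ∑ i, θ i • Bi i)
    (K : Matrix (Fin nu) (Fin nx) ℝ)
    (AK : (Fin p → ℝ) → Matrix (Fin nx) (Fin nx) ℝ)
    (hAK : ∀ θ, AK θ = A θ + B θ * K)
    (F : Matrix (Fin nx) (Fin nw) ℝ) (W : Set (Fin nw → ℝ))
    (𝒳 XT : Set (Fin nx → ℝ)) (𝒰 S : Set (Fin nu → ℝ))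
    (Θ0 Θt Θt1 : Set (Fin p → ℝ)) (hΘ1 : Θt1 ⊆ Θt) (hΘ2 : Θt ⊆ Θ0)
    -- terminal conditions
    (hXT : XT ⊆ 𝒳)
    (hKXT : (fun y => K *ᵥ y) '' XT + S ⊆ 𝒰)
    (hterm : ∀ θ ∈ Θ0,
      (fun y => AK θ *ᵥ y) '' 𝒳 + (fun sv => B θ *ᵥ sv) '' S + (fun wv => F *ᵥ wv) '' W ⊆ XT)
    -- tube feasible at time t
    (X : ℕ → Set (Fin nx → ℝ)) (v : ℕ → Fin nu → ℝ)
    (hstate : ∀ k < N, X k ⊆ 𝒳)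
    (hinput : ∀ k < N, (fun y => K *ᵥ y) '' X k + {v k} ⊆ 𝒰)
    (hrec : ∀ θ ∈ Θt, ∀ k < N,
      (fun y => AK θ *ᵥ y) '' X k + {B θ *ᵥ v k} + (fun wv => F *ᵥ wv) '' W ⊆ X (k + 1))
    (xt : Fin nx → ℝ) (hx0 : xt ∈ X 0) (hXN : X N ⊆ XT)
    -- true system step
    (θstar : Fin p → ℝ) (hθ : θstar ∈ Θt1)
    (wt : Fin nw → ℝ) (hwt : wt ∈ W) (s : Fin nu → ℝ) (hs : s ∈ S)
    (xt1 : Fin nx → ℝ) (hxt1 : xt1 = AK θstar *ᵥ xt + B θstar *ᵥ v 0 + F *ᵥ wt)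
    -- shifted tube and inputs
    (X' : ℕ → Set (Fin nx → ℝ)) (hX' : ∀ k, X' k = if k < N then X (k + 1) else XT)
    (v' : ℕ → Fin nu → ℝ) (hv' : ∀ k, v' k = if k + 1 < N then v (k + 1) else s) :
    (∀ k < N, X' k ⊆ 𝒳) ∧
    (∀ k < N, (fun y => K *ᵥ y) '' X' k + {v' k} ⊆ 𝒰) ∧
    (∀ θ ∈ Θt1, ∀ k < N,
      (fun y => AK θ *ᵥ y) '' X' k + {B θ *ᵥ v' k} + (fun wv => F *ᵥ wv) '' W ⊆ X' (k + 1)) ∧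
    xt1 ∈ X' 0 ∧ X' N ⊆ XT := by
  have hlast : ∀ k < N, ¬ k + 1 < N → X (k + 1) ⊆ XT := by
    intro k hk h
    have : k + 1 = N := by omega
    rw [this]; exact hXN
  have hst : ∀ k < N, X (k + 1) ⊆ 𝒳 := by
    intro k hk
    by_cases h : k + 1 < N
    · exact hstate _ h
    · exact (hlast k hk h).trans hXT
  refine ⟨?_, ?_, ?_, ?_, ?_⟩
  · intro k hk
    rw [hX', if_pos hk]
    exact hst k hk
  · intro k hk
    rw [hX', if_pos hk, hv']
    by_cases h : k + 1 < N
    · rw [if_pos h]; exact hinput _ h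
    · rw [if_neg h]
      exact (Set.add_subset_add (Set.image_mono (hlast k hk h))
        (Set.singleton_subset_iff.2 hs)).trans hKXT
  · intro θ hθ' k hk
    rw [hX' k, if_pos hk, hv', hX' (k + 1)]
    by_cases h : k + 1 < N
    · rw [if_pos h, if_pos h]; exact hrec θ (hΘ1 hθ') _ h
    · rw [if_neg h, if_neg h]
      exact (Set.add_subset_add (Set.add_subset_add (Set.image_mono (hst k hk))
        (Set.singleton_subset_iff.2 (Set.mem_image_of_mem _ hs))) subset_rfl).trans
        (hterm θ (hΘ2 (hΘ1 hθ')))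
  · rw [hX', if_pos (by omega), hxt1]
    exact hrec θstar (hΘ1 hθ) 0 (by omega)
      (Set.add_mem_add (Set.add_mem_add (Set.mem_image_of_mem _ hx0) (Set.mem_singleton _))
        (Set.mem_image_of_mem _ hwt))
  · rw [hX', if_neg (lt_irrefl N)]
end

section
/- (Full-horizon robust constraint satisfaction.) Suppose the terminal conditions hold: 𝒳_T ⊆ 𝒳, K𝒳_T ⊕ 𝒮 ⊆ 𝒰, and A_K(θ)𝒳 ⊕ B(θ)𝒮 ⊕ F𝒲 ⊆ 𝒳_T for all θ ∈ Θ_0. Suppose sets 𝒳_0, …, 𝒳_N ⊆ ℝ^{n_x} and inputs v_0, …, v_{N−1} satisfy, for all θ ∈ Θ ⊆ Θ_0 and k ∈ {0,…,N−1}: 𝒳_k ⊆ 𝒳, K𝒳_k ⊕ {v_k} ⊆ 𝒰, A_K(θ)𝒳_k ⊕ {B(θ)v_k} ⊕ F𝒲 ⊆ 𝒳_{k+1}, x_0 ∈ 𝒳_0, and 𝒳_N ⊆ 𝒳_T. Let the trajectory be x_{k+1} = A_K(θ*) x_k + B(θ*) v_k + F w_k for k < N and x_{k+1} = A_K(θ*)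 x_k + B(θ*) s_k + F w_k for k ≥ N, with θ* ∈ Θ, w_k ∈ 𝒲 and s_k ∈ 𝒮. Then x_k ∈ 𝒳 for all k ≥ 0, and the control inputs u_k = K x_k + v_k (k < N) and u_k = K x_k + s_k (k ≥ N) satisfy u_k ∈ 𝒰 for all k ≥ 0. -/
open Matrix Finset Pointwise

/-- Full-horizon robust constraint satisfaction: a feasible tube over `{0,…,N}` with
terminal conditions guarantees that the closed-loop trajectory (with `u = Kx + v_k`
for `k < N` and `u = Kx + s_k` for `k ≥ N`) satisfies the state and input
constraints for all times. -/
theorem full_horizon_constraint_satisfaction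
    {nx nu nw p N : ℕ}
    (A0 : Matrix (Fin nx) (Fin nx) ℝ) (B0 : Matrix (Fin nx) (Fin nu) ℝ)
    (Ai : Fin p → Matrix (Fin nx) (Fin nx) ℝ) (Bi : Fin p → Matrix (Fin nx) (Fin nu) ℝ)
    (A : (Fin p → ℝ) → Matrix (Fin nx) (Fin nx) ℝ)
    (hA : ∀ θ, A θ = A0 + ∑ i, θ i • Ai i)
    (B : (Fin p → ℝ) → Matrix (Fin nx) (Fin nu) ℝ)
    (hB : ∀ θ, B θ = B0 + ∑ i, θ i • Bi i)
    (K : Matrix (Fin nu) (Fin nx) ℝ)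
    (AK : (Fin p → ℝ) → Matrix (Fin nx) (Fin nx) ℝ)
    (hAK : ∀ θ, AK θ = A θ + B θ * K)
    (F : Matrix (Fin nx) (Fin nw) ℝ) (W : Set (Fin nw → ℝ))
    (𝒳 XT : Set (Fin nx → ℝ)) (𝒰 S : Set (Fin nu → ℝ))
    (Θ0 Θ : Set (Fin p → ℝ)) (hΘ : Θ ⊆ Θ0)
    -- terminal conditions
    (hXT : XT ⊆ 𝒳)
    (hKXT : (fun y => K *ᵥ y) '' XT + S ⊆ 𝒰)
    (hterm : ∀ θ ∈ Θ0,
      (fun y => AK θ *ᵥ y) '' 𝒳 + (fun sv => B θ *ᵥ sv) '' S + (fun wv => F *ᵥ wv) '' W ⊆ XT)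
    -- tube feasibility
    (X : ℕ → Set (Fin nx → ℝ)) (v : ℕ → Fin nu → ℝ)
    (hstate : ∀ k < N, X k ⊆ 𝒳)
    (hinput : ∀ k < N, (fun y => K *ᵥ y) '' X k + {v k} ⊆ 𝒰)
    (hrec : ∀ θ ∈ Θ, ∀ k < N,
      (fun y => AK θ *ᵥ y) '' X k + {B θ *ᵥ v k} + (fun wv => F *ᵥ wv) '' W ⊆ X (k + 1))
    (hXN : X N ⊆ XT)
    -- trajectory
    (θstar : Fin p → ℝ) (hθ : θstar ∈ Θ)
    (x : ℕ → Fin nx → ℝ) (w : ℕ → Fin nw → ℝ) (s : ℕ → Fin nu → ℝ)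
    (hx0 : x 0 ∈ X 0)
    (hw : ∀ k, w k ∈ W) (hs : ∀ k, N ≤ k → s k ∈ S)
    (hdyn1 : ∀ k < N, x (k + 1) = AK θstar *ᵥ x k + B θstar *ᵥ v k + F *ᵥ w k)
    (hdyn2 : ∀ k, N ≤ k → x (k + 1) = AK θstar *ᵥ x k + B θstar *ᵥ s k + F *ᵥ w k) :
    (∀ k : ℕ, x k ∈ 𝒳) ∧
    (∀ k < N, K *ᵥ x k + v k ∈ 𝒰) ∧
    (∀ k, N ≤ k → K *ᵥ x k + s k ∈ 𝒰) := by
  have h1 : ∀ k, k ≤ N → x k ∈ X k := by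
    intro k
    induction k with
    | zero => intro _; exact hx0
    | succ k ih =>
      intro hk
      rw [hdyn1 k (by omega)]
      exact hrec θstar hθ k (by omega)
        (Set.add_mem_add (Set.add_mem_add (Set.mem_image_of_mem _ (ih (by omega)))
          (Set.mem_singleton _)) (Set.mem_image_of_mem _ (hw k)))
  have h2 : ∀ k, N ≤ k → x k ∈ XT := by
    intro k hk
    induction k, hk using Nat.le_induction with
    | base => exact hXN (h1 N le_rfl)
    | succ k hk ih =>
      rw [hdyn2 k hk]
      exact hterm θstar (hΘ hθ)
        (Set.add_mem_add (Set.add_mem_add (Set.mem_image_of_mem _ (hXT ih))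
          (Set.mem_image_of_mem _ (hs k hk))) (Set.mem_image_of_mem _ (hw k)))
  refine ⟨fun k => ?_, fun k hk => ?_, fun k hk => ?_⟩
  · rcases lt_or_ge k N with hk | hk
    · exact hstate k hk (h1 k hk.le)
    · exact hXT (h2 k hk)
  · exact hinput k hk
      (Set.add_mem_add (Set.mem_image_of_mem _ (h1 k hk.le)) (Set.mem_singleton _))
  · exact hKXT (Set.add_mem_add (Set.mem_image_of_mem _ (h2 k hk)) (hs k hk))
end

section
/- (Sample-based persistence-of-excitation check; abstract form of Lemma 2.) Let K ⊂ ℝ^d be a compact convex set with nonempty interior, let f : K → ℝ be L-Lipschitz (L > 0), let g : K → ℝ be any function bounded below on K, and let ε > 0. Let ζ^(1), …, ζ^(N_s) be independent random variables, each uniformly distributed on K, and define δ = min_{1 ≤ i ≤ N_s} f(ζ^(i)) and δ̂ = min_{1 ≤ i ≤ N_s} g(ζ^(i)). Set ρ = 1 − inf_{ζ ∈ K} vol(B(ζ, ε/L) ∩ K)/vol(K), so that ρ ∈ [0, 1). Then the event { δ ≥ δ̂ + ε ⟹ min_{ζ ∈ K} f(ζ) ≥ inf_{ζ ∈ K} g(ζ)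 } has probability at least 1 − ρ^{N_s}. -/
open MeasureTheory Metric ENNReal

/-- Sample-based persistence-of-excitation check (abstract form of Lemma 2): with
`N_s` i.i.d. uniform samples on the compact convex set `K`, the event
"`δ ≥ δ̂ + ε` implies `min_K f ≥ inf_K g`" has probability at least `1 - ρ^{N_s}`,
where `δ, δ̂` are the sampled minima of the `L`-Lipschitz `f` and of `g`, and
`ρ = 1 - inf_{ζ ∈ K} vol(B(ζ, ε/L) ∩ K) / vol K`. -/
theorem sample_based_PE_check
    {d : ℕ} (K : Set (EuclideanSpace ℝ (Fin d)))
    (hKc : IsCompact K) (hKconv : Convex ℝ K) (hKint : (interior K).Nonempty)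
    (L : ℝ) (hL : 0 < L)
    (f g : EuclideanSpace ℝ (Fin d) → ℝ)
    (hf : LipschitzOnWith (Real.toNNReal L) f K)
    (hg : BddBelow (g '' K))
    (ε : ℝ) (hε : 0 < ε)
    (Ns : ℕ) (hNs : 0 < Ns)
    (P : Measure (Fin Ns → EuclideanSpace ℝ (Fin d)))
    (hP : P = Measure.pi fun _ => (volume K)⁻¹ • volume.restrict K)
    (ρ : ℝ≥0∞)
    (hρ : ρ = 1 - (⨅ ζ ∈ K, volume (Metric.closedBall ζ (ε / L) ∩ K)) / volume K) :
    1 - ρ ^ Ns ≤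
      P {ω | (⨅ i, g (ω i)) + ε ≤ ⨅ i, f (ω i) → sInf (g '' K) ≤ sInf (f '' K)} := by
  have hKne : K.Nonempty := hKint.mono interior_subset
  have hv0 : volume K ≠ 0 := fun h => by
    have h1 : volume (interior K) = 0 := measure_mono_null interior_subset h
    exact (isOpen_interior.measure_pos volume hKint).ne' h1
  have hvt : volume K ≠ ⊤ := hKc.measure_lt_top.ne
  have hKm : MeasurableSet K := hKc.isClosed.measurableSet
  obtain ⟨z, hzK, hz⟩ := hKc.exists_isMinOn hKne hf.continuousOn
  have hzmin : f z ≤ sInf (f '' K) := by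
    apply le_csInf (hKne.image f)
    rintro _ ⟨x, hx, rfl⟩
    exact hz hx
  haveI : Nonempty (Fin Ns) := ⟨⟨0, hNs⟩⟩
  set B := Metric.closedBall z (ε / L) with hB
  have hBm : MeasurableSet B := measurableSet_closedBall
  have hsub : (Set.univ.pi fun _ : Fin Ns => K) \ (Set.univ.pi fun _ : Fin Ns => K \ B) ⊆
      {ω | (⨅ i, g (ω i)) + ε ≤ ⨅ i, f (ω i) → sInf (g '' K) ≤ sInf (f '' K)} := by
    rintro ω ⟨hA, hC⟩ h
    have hA' : ∀ i, ω i ∈ K := fun i => hA i trivial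
    have : ∃ i, ω i ∈ B := by
      by_contra hcon
      push Not at hcon
      exact hC fun i _ => ⟨hA' i, hcon i⟩
    obtain ⟨i, hi⟩ := this
    have h1 : (⨅ i, f (ω i)) ≤ f (ω i) := ciInf_le (Set.finite_range _).bddBelow i
    have h2 : sInf (g '' K) ≤ ⨅ i, g (ω i) :=
      le_ciInf fun j => csInf_le hg ⟨ω j, hA' j, rfl⟩
    have h3 : f (ω i) - f z ≤ ε := by
      have h4 := hf.dist_le_mul (ω i) (hA' i) z hzK
      rw [Real.coe_toNNReal L hL.le, Real.dist_eq] at h4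
      have h5 : L * dist (ω i) z ≤ L * (ε / L) :=
        mul_le_mul_of_nonneg_left (Metric.mem_closedBall.1 hi) hL.le
      rw [mul_div_cancel₀ _ hL.ne'] at h5
      exact (le_abs_self _).trans (h4.trans h5)
    linarith
  refine le_trans ?_ (measure_mono hsub)
  refine le_trans ?_ le_measure_diff
  have hfin : IsFiniteMeasure ((volume K)⁻¹ • volume.restrict K) := by
    constructor
    simp only [Measure.smul_apply, smul_eq_mul, Measure.restrict_apply_univ]
    rw [ENNReal.inv_mul_cancel hv0 hvt]
    exact ENNReal.one_lt_top
  have hBK : volume (K \ B) = volume K - volume (B ∩ K) := by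
    rw [← Set.diff_inter_self_eq_diff, measure_diff Set.inter_subset_right
      (hBm.inter hKm).nullMeasurableSet
      (measure_ne_top_of_subset Set.inter_subset_right hvt)]
  rw [hP, Measure.pi_pi, Measure.pi_pi]
  simp only [Measure.smul_apply, smul_eq_mul, Measure.restrict_apply_self,
    ENNReal.inv_mul_cancel hv0 hvt, Finset.prod_const, Finset.card_univ, Fintype.card_fin, one_pow]
  gcongr
  rw [Measure.restrict_apply (hKm.diff hBm), Set.inter_eq_left.2 Set.diff_subset, hBK, hρ,
    mul_comm, ← div_eq_mul_inv, ENNReal.sub_div (fun _ _ => hv0), ENNReal.div_self hv0 hvt]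
  gcongr
  exact iInf₂_le z hzK
end

section
/- (Sample-based lower bound on the minimum of a Lipschitz function.) Let K ⊂ ℝ^d be a compact convex set with nonempty interior, let f : K → ℝ be L-Lipschitz (L > 0) and let ε > 0. Let ζ^(1), …, ζ^(N_s) be independent random variables, each uniformly distributed on K. Set ρ = 1 − inf_{ζ ∈ K} vol(B(ζ, ε/L) ∩ K)/vol(K) ∈ [0, 1). Then with probability at least 1 − ρ^{N_s}, min_{ζ ∈ K} f(ζ) ≥ min_{1 ≤ i ≤ N_s} f(ζ^(i)) − ε. -/
open MeasureTheory Metric ENNReal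

/-- Sample-based lower bound on the minimum of a Lipschitz function: with `N_s` i.i.d.
uniform samples on the compact convex `K`, with probability at least `1 - ρ^{N_s}`,
`min_K f ≥ min_i f(ζ^{(i)}) - ε`, where
`ρ = 1 - inf_{ζ ∈ K} vol(B(ζ, ε/L) ∩ K) / vol K`. -/
theorem sample_based_min_lower_bound
    {d : ℕ} (K : Set (EuclideanSpace ℝ (Fin d)))
    (hKc : IsCompact K) (hKconv : Convex ℝ K) (hKint : (interior K).Nonempty)
    (L : ℝ) (hL : 0 < L)
    (f : EuclideanSpace ℝ (Fin d) → ℝ)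
    (hf : LipschitzOnWith (Real.toNNReal L) f K)
    (ε : ℝ) (hε : 0 < ε)
    (Ns : ℕ) (hNs : 0 < Ns)
    (P : Measure (Fin Ns → EuclideanSpace ℝ (Fin d)))
    (hP : P = Measure.pi fun _ => (volume K)⁻¹ • volume.restrict K)
    (ρ : ℝ≥0∞)
    (hρ : ρ = 1 - (⨅ ζ ∈ K, volume (Metric.closedBall ζ (ε / L) ∩ K)) / volume K) :
    1 - ρ ^ Ns ≤ P {ω | (⨅ i, f (ω i)) - ε ≤ sInf (f '' K)} := by
  obtain ⟨x0, hx0⟩ := hKint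
  have hKne : K.Nonempty := ⟨x0, interior_subset hx0⟩
  have hK0 : volume K ≠ 0 := by
    have h1 : 0 < volume (interior K) := isOpen_interior.measure_pos _ ⟨x0, hx0⟩
    exact (h1.trans_le (measure_mono interior_subset)).ne'
  have hKt : volume K ≠ ⊤ := hKc.measure_lt_top.ne
  obtain ⟨z, hz, hmin⟩ := hKc.exists_isMinOn hKne hf.continuousOn
  have hsInf : f z ≤ sInf (f '' K) := by
    apply le_csInf (hKne.image f)
    rintro _ ⟨y, hy, rfl⟩
    exact hmin hy
  set μ : Measure (EuclideanSpace ℝ (Fin d)) := (volume K)⁻¹ • volume.restrict K with hμ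
  have hprob : IsProbabilityMeasure μ := by
    constructor
    simp [hμ, ENNReal.inv_mul_cancel hK0 hKt]
  set A := Metric.closedBall z (ε / L) ∩ K with hA
  have hAm : MeasurableSet A := measurableSet_closedBall.inter hKc.measurableSet
  have hμA : μ A = volume A / volume K := by
    have h2 : A ∩ K = A := by
      rw [hA, Set.inter_assoc, Set.inter_self]
    rw [hμ, Measure.smul_apply, Measure.restrict_apply hAm, h2, smul_eq_mul, mul_comm,
      div_eq_mul_inv]
  have hρA : μ Aᶜ ≤ ρ := by
    rw [prob_compl_eq_one_sub hAm, hρ, hμA]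
    apply tsub_le_tsub_left
    exact ENNReal.div_le_div_right (iInf₂_le z hz) _
  have hBm : MeasurableSet (Set.univ.pi fun _ : Fin Ns => Aᶜ) :=
    MeasurableSet.univ_pi fun _ => hAm.compl
  have hPp : IsProbabilityMeasure P := by
    rw [hP]; infer_instance
  have hPB : P (Set.univ.pi fun _ : Fin Ns => Aᶜ) = (μ Aᶜ) ^ Ns := by
    rw [hP, Measure.pi_pi]
    simp
  calc 1 - ρ ^ Ns ≤ 1 - (μ Aᶜ) ^ Ns := by
        apply tsub_le_tsub_left
        exact pow_le_pow_left' hρA Ns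
    _ = P (Set.univ.pi fun _ : Fin Ns => Aᶜ)ᶜ := by
        rw [prob_compl_eq_one_sub hBm, hPB]
    _ ≤ _ := by
        apply measure_mono
        intro ω hω
        simp only [Set.mem_compl_iff, Set.mem_pi, Set.mem_univ, true_imp_iff, not_forall,
          not_not] at hω
        obtain ⟨i, hi⟩ := hω
        have h1 : (⨅ i, f (ω i)) ≤ f (ω i) := ciInf_le (Set.finite_range _).bddBelow i
        have h2 := hf.dist_le_mul (ω i) hi.2 z hz
        have h3 : dist (ω i) z ≤ ε / L := hi.1
        rw [Real.coe_toNNReal L hL.le, Real.dist_eq] at h2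
        have h4 : L * dist (ω i) z ≤ ε := by
          rw [le_div_iff₀ hL] at h3
          linarith
        have h5 := le_abs_self (f (ω i) - f z)
        show (⨅ i, f (ω i)) - ε ≤ sInf (f '' K)
        linarith
end

section
/- (Deterministic falsification of distant parameters under persistent excitation.) Let the trajectory satisfy x_{k+1} = Φ(x_k,u_k) θ* + φ(x_k,u_k) + F w_k with w_k ∈ 𝒲 for all k, and write Φ_k = Φ(x_k,u_k). Let M = sup_{w ∈ 𝒲} ‖Fw‖ (finite since 𝒲 is compact). Suppose the PE condition Σ_{k=t}^{t+N_u−1} Φ_kᵀΦ_k ⪰ ε_Φ I holds for some ε_Φ > 0. Then every θ ∈ ℝ^p with ‖θ − θ*‖ > 2M √(N_u/ε_Φ) is falsified within the window: there exists k ∈ {t, …, t+N_u−1} such that x_{k+1} − Φ_k θ − φ(x_k,u_k) ∉ F𝒲, i.e. θ ∉ Δ_{k+1}. -/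
open Matrix Finset

/-- The Euclidean norm of a vector in `ℝ^m`. -/
noncomputable def euclNorm {m : ℕ} (v : Fin m → ℝ) : ℝ := Real.sqrt (v ⬝ᵥ v)

/-- Deterministic falsification of distant parameters under persistent excitation:
if the PE condition `Σ_{k=t}^{t+N_u−1} Φ_kᵀΦ_k ⪰ ε_Φ I` holds along the true-system
trajectory and `M = sup_{w ∈ 𝒲} ‖Fw‖`, then every `θ` with
`‖θ − θ*‖ > 2M √(N_u/ε_Φ)` is falsified at some step of the window. -/
theorem PE_falsifies_distant_parameters
    {nx nu nw p : ℕ}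
    (A0 : Matrix (Fin nx) (Fin nx) ℝ) (B0 : Matrix (Fin nx) (Fin nu) ℝ)
    (Ai : Fin p → Matrix (Fin nx) (Fin nx) ℝ) (Bi : Fin p → Matrix (Fin nx) (Fin nu) ℝ)
    (F : Matrix (Fin nx) (Fin nw) ℝ) (W : Set (Fin nw → ℝ))
    (hWc : IsCompact W) (hWconv : Convex ℝ W)
    (θstar : Fin p → ℝ)
    (x : ℕ → Fin nx → ℝ) (u : ℕ → Fin nu → ℝ) (w : ℕ → Fin nw → ℝ)
    (Φm : ℕ → Matrix (Fin nx) (Fin p) ℝ)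
    (hΦm : ∀ k : ℕ, ∀ i : Fin nx, ∀ j : Fin p,
      Φm k i j = (Ai j *ᵥ x k + Bi j *ᵥ u k) i)
    (hw : ∀ k, w k ∈ W)
    (hdyn : ∀ k : ℕ,
      x (k + 1) = Φm k *ᵥ θstar + (A0 *ᵥ x k + B0 *ᵥ u k) + F *ᵥ w k)
    (M : ℝ) (hM : M = sSup ((fun wv => euclNorm (F *ᵥ wv)) '' W))
    (t Nu : ℕ) (hNu : 0 < Nu) (εΦ : ℝ) (hεΦ : 0 < εΦ)
    (hPE : (∑ k ∈ Finset.range Nu, (Φm (t + k))ᵀ * Φm (t + k)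
        - εΦ • (1 : Matrix (Fin p) (Fin p) ℝ)).PosSemidef) :
    ∀ θ : Fin p → ℝ, 2 * M * Real.sqrt ((Nu : ℝ) / εΦ) < euclNorm (θ - θstar) →
      ∃ k < Nu,
        x (t + k + 1) - Φm (t + k) *ᵥ θ - (A0 *ᵥ x (t + k) + B0 *ᵥ u (t + k))
          ∉ (fun wv => F *ᵥ wv) '' W := by
  intro θ hθ
  by_contra hcon
  push Not at hcon
  have hcont : Continuous (fun wv : Fin nw → ℝ => euclNorm (F *ᵥ wv)) := by
    unfold euclNorm
    have h1 : Continuous (fun wv : Fin nw → ℝ => F *ᵥ wv) :=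
      Continuous.matrix_mulVec continuous_const continuous_id
    exact Real.continuous_sqrt.comp (Continuous.dotProduct h1 h1)
  have hb : BddAbove ((fun wv => euclNorm (F *ᵥ wv)) '' W) := (hWc.image hcont).bddAbove
  have hle : ∀ v ∈ W, euclNorm (F *ᵥ v) ≤ M := fun v hv => by
    rw [hM]; exact le_csSup hb ⟨v, hv, rfl⟩
  have hM0 : 0 ≤ M := le_trans (Real.sqrt_nonneg _) (hle _ (hw 0))
  have hsq : ∀ v ∈ W, (F *ᵥ v) ⬝ᵥ (F *ᵥ v) ≤ M ^ 2 := fun v hv =>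
    (Real.sqrt_le_left hM0).1 (hle v hv)
  set d := θ - θstar with hd
  have hk : ∀ k ∈ Finset.range Nu,
      (Φm (t + k) *ᵥ d) ⬝ᵥ (Φm (t + k) *ᵥ d) ≤ 4 * M ^ 2 := by
    intro k hk
    obtain ⟨v, hv, hve⟩ := hcon k (Finset.mem_range.1 hk)
    have h1 := hsq v hv
    have h2 := hsq _ (hw (t + k))
    have he : Φm (t + k) *ᵥ d = F *ᵥ w (t + k) - F *ᵥ v := by
      have hve' : F *ᵥ v = _ := hve
      rw [hve', hdyn (t + k), hd, Matrix.mulVec_sub]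
      abel
    have h3 : 0 ≤ (F *ᵥ w (t + k) + F *ᵥ v) ⬝ᵥ (F *ᵥ w (t + k) + F *ᵥ v) :=
      Finset.sum_nonneg fun i _ => mul_self_nonneg _
    rw [he]
    simp only [sub_dotProduct, dotProduct_sub, add_dotProduct, dotProduct_add] at h3 ⊢
    linarith
  have hpe := hPE.dotProduct_mulVec_nonneg d
  simp only [Matrix.sub_mulVec, Matrix.sum_mulVec, Matrix.smul_mulVec, Matrix.one_mulVec,
    dotProduct_sub, dotProduct_sum, dotProduct_smul, star_trivial, smul_eq_mul] at hpe
  have hs : ∑ k ∈ Finset.range Nu, d ⬝ᵥ (((Φm (t + k))ᵀ * Φm (t + k)) *ᵥ d)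
      ≤ ∑ k ∈ Finset.range Nu, 4 * M ^ 2 := by
    refine Finset.sum_le_sum fun k hkk => ?_
    have := hk k hkk
    rwa [← Matrix.mulVec_mulVec, Matrix.dotProduct_mulVec, Matrix.vecMul_transpose]
  rw [Finset.sum_const, Finset.card_range, nsmul_eq_mul] at hs
  have h0 : 0 ≤ 2 * M * Real.sqrt ((Nu : ℝ) / εΦ) := by positivity
  have hlt := (Real.lt_sqrt h0).1 hθ
  rw [mul_pow, Real.sq_sqrt (by positivity)] at hlt
  have h5 : εΦ * ((2 * M) ^ 2 * ((Nu : ℝ) / εΦ)) = Nu * (4 * M ^ 2) := by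
    field_simp; ring
  have h6 := mul_lt_mul_of_pos_left hlt hεΦ
  linarith
end
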